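/- Let p be an odd prime and n a positive integer, let G = ℤ_p ≀ Sym_n = V ⋊ B as described, and let H be a subgroup of G with H̄ = B (H projects onto Sym_n). If V⁻ ≤ H, then H equals BV⁻ (the subgroup generated by B and V⁻) or H = G; in either case H is a normal subgroup of G. -/

import Mathlib

/-- A subgroup `H` of a group `G` is *pronormal* in `G` if for every `g : G` the subgroups
`H` and `H^g` are conjugate by an element of the subgroup `⟨H, H^g⟩` they generate. -/
def IsPronormal {G : Type*} [Group G] (H : Subgroup G) : Prop :=
  ∀ g : G, ∃ x ∈ H ⊔ H.map (MulAut.conj g).toMonoidHom,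
    H.map (MulAut.conj x).toMonoidHom = H.map (MulAut.conj g).toMonoidHom

/-- The action of `Sym n` on `n`-tuples over `A` by permutation of coordinates. -/
def permAction (n : ℕ) (A : Type*) [AddCommGroup A] :
    Equiv.Perm (Fin n) →* MulAut (Multiplicative (Fin n → A)) where
  toFun σ := AddEquiv.toMultiplicative
    { Equiv.arrowCongr σ (Equiv.refl A) with map_add' := fun _ _ => rfl }
  map_one' := by ext v; rfl
  map_mul' := fun σ τ => by ext v; rfl

/-- The wreath product `ℤ_p ≀ Sym_n` realized as the semidirect product `V ⋊ B`,
where `V = (Fin n → ZMod p)` and `B = Equiv.Perm (Fin n)` permutes coordinates. -/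
abbrev Wreath (p n : ℕ) : Type :=
  Multiplicative (Fin n → ZMod p) ⋊[permAction n (ZMod p)] Equiv.Perm (Fin n)

/-- The additive subgroup of constant tuples. -/
def constTuples (p n : ℕ) : AddSubgroup (Fin n → ZMod p) where
  carrier := {v | ∀ i j, v i = v j}
  add_mem' := fun ha hb i j => by simp only [Pi.add_apply, ha i j, hb i j]
  zero_mem' := fun i j => rfl
  neg_mem' := fun ha i j => by simp only [Pi.neg_apply, ha i j]

/-- The additive subgroup of tuples whose coordinates sum to `0`. -/
def sumZero (p n : ℕ) : AddSubgroup (Fin n → ZMod p) where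
  carrier := {v | ∑ i, v i = 0}
  add_mem' := fun {a b} ha hb => by
    simp only [Set.mem_setOf_eq, Pi.add_apply, Finset.sum_add_distrib] at *
    rw [ha, hb, add_zero]
  zero_mem' := by simp
  neg_mem' := fun {a} ha => by
    simp only [Set.mem_setOf_eq, Pi.neg_apply, Finset.sum_neg_distrib] at *
    rw [ha, neg_zero]

/-- `V` as a subgroup of the wreath product. -/
def Vfull (p n : ℕ) : Subgroup (Wreath p n) := SemidirectProduct.inl.range

/-- `V⁺`, the constant tuples, as a subgroup of the wreath product. -/
def Vplus (p n : ℕ) : Subgroup (Wreath p n) :=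
  (AddSubgroup.toSubgroup (constTuples p n)).map SemidirectProduct.inl

/-- `V⁻`, the tuples with coordinate sum `0`, as a subgroup of the wreath product. -/
def Vminus (p n : ℕ) : Subgroup (Wreath p n) :=
  (AddSubgroup.toSubgroup (sumZero p n)).map SemidirectProduct.inl

/-- `B = Sym_n` as a subgroup of the wreath product. -/
def Bsub (p n : ℕ) : Subgroup (Wreath p n) := SemidirectProduct.inr.range

/-- The homomorphism `ℤ_p ≀ Sym_n → ℤ_p` sending `vb` to the sum of the coordinates of `v`. -/
def coordSum (p n : ℕ) : Wreath p n →* Multiplicative (ZMod p) where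
  toFun g := Multiplicative.ofAdd (∑ i, g.left.toAdd i)
  map_one' := by simp
  map_mul' a b := by
    rw [← ofAdd_add]
    congr 1
    have h : ∑ i, (permAction n (ZMod p) a.right b.left).toAdd i = ∑ i, b.left.toAdd i :=
      Equiv.sum_comp a.right.symm (fun i => b.left.toAdd i)
    simp [SemidirectProduct.mul_left, Finset.sum_add_distrib, h]

theorem mem_Vminus_iff {p n : ℕ} {g : Wreath p n} :
    g ∈ Vminus p n ↔ g.right = 1 ∧ coordSum p n g = 1 := by
  constructor
  · rintro ⟨v, hv, rfl⟩
    exact ⟨rfl, congrArg Multiplicative.ofAdd hv⟩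
  · rintro ⟨h₁, h₂⟩
    exact ⟨g.left, congrArg Multiplicative.toAdd h₂, SemidirectProduct.ext rfl h₁.symm⟩

theorem Bsub_sup_Vminus (p n : ℕ) : Bsub p n ⊔ Vminus p n = (coordSum p n).ker := by
  have hB : Bsub p n ≤ (coordSum p n).ker := by
    rintro _ ⟨b, rfl⟩
    simp [MonoidHom.mem_ker, coordSum]
  refine le_antisymm (sup_le hB fun g hg => (mem_Vminus_iff.1 hg).2) fun g hg => ?_
  have hb : SemidirectProduct.inr g.right ∈ Bsub p n := ⟨g.right, rfl⟩
  have hv : g * (SemidirectProduct.inr g.right)⁻¹ ∈ Vminus p n :=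
    mem_Vminus_iff.2 ⟨by simp, MonoidHom.mem_ker.1 (mul_mem hg (inv_mem (hB hb)))⟩
  simpa using mul_mem ((le_sup_right : _ ≤ Bsub p n ⊔ Vminus p n) hv)
    ((le_sup_left : _ ≤ Bsub p n ⊔ Vminus p n) hb)

/-- A subgroup containing `V⁻` and `h` contains every `g` with the same coordinate sum and the same
projection to `Sym_n` as `h`. -/
theorem mem_of_Vminus_le {p n : ℕ} {H : Subgroup (Wreath p n)} (hV : Vminus p n ≤ H)
    {g h : Wreath p n} (hh : h ∈ H) (hr : g.right = h.right)
    (hs : coordSum p n g = coordSum p n h) : g ∈ H := by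
  have : g * h⁻¹ ∈ H := hV (mem_Vminus_iff.2 ⟨by simp [hr], by simp [hs]⟩)
  simpa using mul_mem this hh

theorem eq_top_of_coordSum_ne_one {p n : ℕ} (hp : p.Prime) {H : Subgroup (Wreath p n)}
    (hH : H.map SemidirectProduct.rightHom = ⊤) (hV : Vminus p n ≤ H)
    {v : Wreath p n} (hv : v ∈ H) (hr : v.right = 1) (hs : coordSum p n v ≠ 1) : H = ⊤ := by
  have := Fact.mk hp
  refine (Subgroup.eq_top_iff' H).2 fun g => ?_
  obtain ⟨h, hh, hg⟩ : g.right ∈ H.map SemidirectProduct.rightHom := hH ▸ Subgroup.mem_top _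
  have hcard : Nat.card (Multiplicative (ZMod p)) = p := by simp
  obtain ⟨k, hk⟩ := Subgroup.mem_zpowers_iff.1
    (mem_zpowers_of_prime_card (g' := coordSum p n g * (coordSum p n h)⁻¹) hcard hs)
  have hvk : (v ^ k).right = 1 := by
    change SemidirectProduct.rightHom (v ^ k) = 1
    rw [map_zpow]
    simp [hr]
  exact mem_of_Vminus_le hV (mul_mem (zpow_mem hv k) hh)
    (by simpa [hvk] using hg.symm) (by simp [hk])

theorem le_ker_coordSum {p n : ℕ} (hodd : Odd p) {H : Subgroup (Wreath p n)}
    (hH : H.map SemidirectProduct.rightHom = ⊤)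
    (hs : ∀ v ∈ H, v.right = 1 → coordSum p n v = 1) : H ≤ (coordSum p n).ker := by
  have hK : (H ⊓ (coordSum p n).ker).map SemidirectProduct.rightHom = ⊤ := by
    rw [eq_top_iff, ← Equiv.Perm.closure_isSwap, Subgroup.closure_le]
    rintro σ ⟨x, y, -, rfl⟩
    obtain ⟨h, hh, hσ⟩ : Equiv.swap x y ∈ H.map SemidirectProduct.rightHom :=
      hH ▸ Subgroup.mem_top _
    refine ⟨h, ⟨hh, ?_⟩, hσ⟩
    have hsq : coordSum p n h ^ 2 = 1 := by
      rw [← map_pow]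
      refine hs _ (pow_mem hh 2) ?_
      change SemidirectProduct.rightHom (h ^ 2) = 1
      rw [map_pow, hσ, sq, Equiv.swap_mul_self]
    have hpow : coordSum p n h ^ p = 1 := by
      rw [← toAdd_eq_zero, toAdd_pow, nsmul_eq_mul, CharP.cast_eq_zero, zero_mul]
    exact MonoidHom.mem_ker.2
      ((pow_eq_one_iff_of_coprime hodd.coprime_two_right.symm).1 ⟨hsq, hpow⟩)
  intro h hh
  obtain ⟨k, ⟨hkH, hk⟩, hr⟩ :
      h.right ∈ (H ⊓ (coordSum p n).ker).map SemidirectProduct.rightHom :=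
    hK ▸ Subgroup.mem_top _
  have hr' : k.right = h.right := hr
  have := hs (h * k⁻¹) (mul_mem hh (inv_mem hkH)) (by simp [hr'])
  rw [map_mul, map_inv, MonoidHom.mem_ker.1 hk] at this
  simpa [MonoidHom.mem_ker] using this

/-- If `p` is an odd prime, `H ≤ ℤ_p ≀ Sym_n` projects onto `Sym_n` and `V⁻ ≤ H`, then
`H ∈ {BV⁻, G}` and `H` is normal. -/
theorem eq_BVminus_or_top_of_Vminus_le (p n : ℕ) (hp : p.Prime) (hodd : Odd p) (hn : 0 < n)
    (H : Subgroup (Wreath p n)) (hH : H.map SemidirectProduct.rightHom = ⊤)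
    (hV : Vminus p n ≤ H) :
    (H = Bsub p n ⊔ Vminus p n ∨ H = ⊤) ∧ H.Normal := by
  by_cases hs : ∀ v ∈ H, v.right = 1 → coordSum p n v = 1
  · have hker : H = (coordSum p n).ker := by
      refine le_antisymm (le_ker_coordSum hodd hH hs) fun g hg => ?_
      obtain ⟨h, hh, hr⟩ : g.right ∈ H.map SemidirectProduct.rightHom := hH ▸ Subgroup.mem_top _
      refine mem_of_Vminus_le hV hh hr.symm ?_
      rw [MonoidHom.mem_ker.1 hg, MonoidHom.mem_ker.1 (le_ker_coordSum hodd hH hs hh)]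
    exact ⟨.inl (hker.trans (Bsub_sup_Vminus p n).symm), hker ▸ inferInstance⟩
  · push Not at hs
    obtain ⟨v, hv, hr, hne⟩ := hs
    have htop := eq_top_of_coordSum_ne_one hp hH hV hv hr hne
    exact ⟨.inr htop, htop ▸ inferInstance⟩
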